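/- Let ∃X.F be an ∃CNF formula and q an assignment to Vars(F). Let C be an X-clause of F not satisfied by q, and let v ∈ X be a variable of C with v ∉ Vars(q). If the clause C|_q is blocked at v in F|_q, then C|_q is redundant in ∃X.(F|_q). -/

import Mathlib

namespace QE

noncomputable section

attribute [local instance] Classical.propDecidable

/-- A literal: a variable together with a polarity. -/
structure Lit (V : Type) where
  var : V
  pos : Bool
deriving DecidableEq

variable {V : Type} [DecidableEq V]

/-- A clause is a (finite) disjunction of literals. -/
abbrev Clause (V : Type) := Finset (Lit V)

/-- A CNF formula is a (finite) set of clauses. -/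
abbrev Cnf (V : Type) := Finset (Clause V)

/-- The variables of a clause. -/
def Clause.vars (C : Clause V) : Finset V := C.image Lit.var

/-- The variables of a CNF formula. -/
def Cnf.vars (F : Cnf V) : Finset V := F.sup Clause.vars

/-- A total assignment (point) `t` satisfies the clause `C`. -/
def Clause.satAt (t : V → Bool) (C : Clause V) : Prop := ∃ l ∈ C, t l.var = l.pos

/-- A total assignment (point) `t` falsifies the clause `C`. -/
def Clause.falsAt (t : V → Bool) (C : Clause V) : Prop := ∀ l ∈ C, t l.var = !l.pos

/-- A total assignment (point) `t` satisfies the CNF formula `F`. -/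
def Cnf.satAt (t : V → Bool) (F : Cnf V) : Prop := ∀ C ∈ F, Clause.satAt t C

/-- A partial assignment: it assigns Boolean values to some of the variables. -/
abbrev PAssign (V : Type) := V → Option Bool

/-- The set of variables assigned in `q`. -/
def PAssign.dom (q : PAssign V) : Set V := {v | q v ≠ none}

/-- `q ⊆ r` for partial assignments (viewed as sets of value assignments). -/
def PAssign.le (q r : PAssign V) : Prop := ∀ v b, q v = some b → r v = some b

/-- `q ⊊ r` for partial assignments. -/
def PAssign.lt (q r : PAssign V) : Prop := PAssign.le q r ∧ q ≠ r

/-- The point (total assignment) `t` extends the partial assignment `q`. -/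
def ExtendsPnt (t : V → Bool) (q : PAssign V) : Prop := ∀ v b, q v = some b → t v = b

/-- Two partial assignments are compatible if every commonly assigned
variable gets the same value in both. -/
def PAssign.compatible (q r : PAssign V) : Prop :=
  ∀ v b b', q v = some b → r v = some b' → b = b'

/-- The union of two partial assignments. -/
def PAssign.union (q r : PAssign V) : PAssign V := fun v => (q v).orElse fun _ => r v

/-- The clause `C` is satisfied by the partial assignment `q`. -/
def Clause.satBy (q : PAssign V) (C : Clause V) : Prop := ∃ l ∈ C, q l.var = some l.pos

/-- The cofactor `C|_q` of an (unsatisfied) clause: remove the literals falsified by `q`. -/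
def Clause.restrict (q : PAssign V) (C : Clause V) : Clause V :=
  C.filter fun l => q l.var ≠ some (!l.pos)

/-- The cofactor `F|_q` of a CNF formula: drop the clauses satisfied by `q`
(they became `true`) and remove the falsified literals from the remaining clauses. -/
def Cnf.restrict (q : PAssign V) (F : Cnf V) : Cnf V :=
  (F.filter fun C => ¬ Clause.satBy q C).image (Clause.restrict q)

/-- The formula `∃X.F` evaluates to true at the point `t`. -/
def ExSat (X : Finset V) (F : Cnf V) (t : V → Bool) : Prop :=
  ∃ t' : V → Bool, (∀ v, v ∉ X → t' v = t v) ∧ Cnf.satAt t' F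

/-- Equivalence `∃X.F ≡ ∃X.G`. -/
def Eqv (X : Finset V) (F G : Cnf V) : Prop := ∀ t : V → Bool, ExSat X F t ↔ ExSat X G t

/-- The set `G` of clauses of `F` is redundant in `∃X.F`, i.e. `∃X.F ≡ ∃X.(F \ G)`. -/
def RedundantSet (X : Finset V) (F G : Cnf V) : Prop := Eqv X F (F \ G)

/-- The CNF formula `F` implies the clause `C`. -/
def CnfImplies (F : Cnf V) (C : Clause V) : Prop :=
  ∀ t : V → Bool, Cnf.satAt t F → Clause.satAt t C

/-- The CNF formula `F` implies the CNF formula `R`. -/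
def CnfImpliesCnf (F R : Cnf V) : Prop :=
  ∀ t : V → Bool, Cnf.satAt t F → Cnf.satAt t R

/-- `C` is a `Z`-clause, i.e. `Vars(C) ∩ Z ≠ ∅`. -/
def XClause (Z : Finset V) (C : Clause V) : Prop := (Clause.vars C ∩ Z).Nonempty

/-- The point `p` is a `Z`-boundary point of `F`. -/
def BoundaryPnt (F : Cnf V) (Z : Finset V) (p : V → Bool) : Prop :=
  Z.Nonempty ∧ Z ⊆ Cnf.vars F ∧ ¬ Cnf.satAt p F ∧
  (∀ C ∈ F, Clause.falsAt p C → XClause Z C) ∧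
  ∀ Z' ⊂ Z, ¬ ∀ C ∈ F, Clause.falsAt p C → XClause Z' C

/-- The point `p` is `X'`-removable in `F`: there is a clause `C` implied by `F`,
with no variable in `X'`, falsified by `p`. -/
def Removable (F : Cnf V) (X' : Finset V) (p : V → Bool) : Prop :=
  ∃ C : Clause V, CnfImplies F C ∧ Clause.vars C ∩ X' = ∅ ∧ Clause.falsAt p C

/-- `q*`: remove from `q` all value assignments to variables of `X`. -/
def stripX (X : Finset V) (q : PAssign V) : PAssign V := fun v => if v ∈ X then none else q v

/-- The clause `C|_q` is virtually redundant in `∃X.(F|_q)`: for every point `p`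
such that the only clause of `F|_q` falsified by `p` is `C|_q` and `p` is
`X`-removable in `F|_q`, there is an assignment `r` with `q* ⊆ r ⊊ q` such that
`p` is not `X`-removable in `F|_r`.  (If the set of such points `p` is empty
this holds vacuously, which is exactly regular redundancy.) -/
def VirtRed (X : Finset V) (F : Cnf V) (q : PAssign V) (C : Clause V) : Prop :=
  ∀ p : V → Bool,
    Clause.falsAt p (Clause.restrict q C) →
    (∀ D ∈ Cnf.restrict q F, Clause.falsAt p D → D = Clause.restrict q C) →
    Removable (Cnf.restrict q F) X p →
    ∃ r : PAssign V, PAssign.le (stripX X q) r ∧ PAssign.lt r q ∧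
      ¬ Removable (Cnf.restrict r F) X p

/-- The D-sequent `(∃X.F, q, H) → C` holds: for every member formula `W` with
`H ∪ {C} ⊆ W ⊆ F` such that `∃X.(W|_q) ≡ ∃X.(F|_q)`, the clause `C|_q` is
(at least virtually) redundant in `∃X.(W|_q)`. -/
def IsDseq (X : Finset V) (F : Cnf V) (q : PAssign V) (H : Cnf V) (C : Clause V) : Prop :=
  ∀ W : Cnf V, H ∪ {C} ⊆ W → W ⊆ F →
    Eqv X (Cnf.restrict q W) (Cnf.restrict q F) → VirtRed X W q C

/-- Consistency of the set of D-sequents `(q^i, H_i) → C_i`, `i = 1,…,k`: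
the conditionals are pairwise compatible and there is a total order `π` on the
clauses of `⋃ᵢ (H_i ∪ {C_i})` satisfying the order constraints. -/
def Consistent {k : ℕ} (qs : Fin k → PAssign V) (Hs : Fin k → Cnf V)
    (Cs : Fin k → Clause V) : Prop :=
  (∀ i j, PAssign.compatible (qs i) (qs j)) ∧
  ∃ π : Clause V → ℕ,
    Set.InjOn π (⋃ i, ((Hs i ∪ {Cs i} : Cnf V) : Set (Clause V))) ∧
    ∀ i, ∀ D ∈ Hs i, π (Cs i) < π D

/-- Clauses `C` and `D` are resolvable on `v`: they have opposite literals of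
exactly one variable, namely `v`. -/
def ClResolvable (C D : Clause V) (v : V) : Prop :=
  (∃ b : Bool, (⟨v, b⟩ : Lit V) ∈ C ∧ (⟨v, !b⟩ : Lit V) ∈ D) ∧
  ∀ u, u ≠ v → ∀ b : Bool, (⟨u, b⟩ : Lit V) ∈ C → (⟨u, !b⟩ : Lit V) ∉ D

/-- The clause `C` is blocked at variable `v` in the CNF formula `G`. -/
def Blocked (G : Cnf V) (C : Clause V) (v : V) : Prop := ∀ D ∈ G, ¬ ClResolvable C D v

/-- Assignments `q` and `r` are resolvable on `v`: exactly one commonly assigned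
variable, namely `v`, is assigned different values. -/
def PResolvable (q r : PAssign V) (v : V) : Prop :=
  (∃ b : Bool, q v = some b ∧ r v = some (!b)) ∧
  ∀ u, u ≠ v → ∀ b b' : Bool, q u = some b → r u = some b' → b = b'

/-- The resolvent of assignments `q` and `r` on `v`: all value assignments of
`q` and `r` except those to `v`. -/
def PResolvent (q r : PAssign V) (v : V) : PAssign V :=
  fun u => if u = v then none else (q u).orElse fun _ => r u

/-- If the `X`-clause `C` of `F` is not satisfied by `q`, `v ∈ X` is a
variable of `C` unassigned in `q`, and `C|_q` is blocked at `v` in `F|_q`, then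
`C|_q` is redundant in `∃X.(F|_q)`. -/
theorem blocked_clause_redundant
    (X : Finset V) (F : Cnf V) (q : PAssign V)
    (hq : PAssign.dom q ⊆ ↑(Cnf.vars F))
    (C : Clause V) (hC : C ∈ F) (hCX : XClause X C) (hCns : ¬ Clause.satBy q C)
    (v : V) (hvX : v ∈ X) (hvC : v ∈ Clause.vars C) (hvq : q v = none)
    (hblk : Blocked (Cnf.restrict q F) (Clause.restrict q C) v) :
    Eqv X (Cnf.restrict q F) ((Cnf.restrict q F).erase (Clause.restrict q C)) := by
  intro t
  constructor
  · rintro ⟨t', h1, h2⟩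
    exact ⟨t', h1, fun D hD => h2 D (Finset.mem_of_mem_erase hD)⟩
  rintro ⟨t', h1, h2⟩
  have hKv : ∃ b : Bool, (⟨v, b⟩ : Lit V) ∈ Clause.restrict q C := by
    obtain ⟨⟨w, b⟩, hl, hw⟩ := Finset.mem_image.1 hvC
    have hwv : w = v := hw
    subst hwv
    exact ⟨b, Finset.mem_filter.2 ⟨hl, by simp [hvq]⟩⟩
  generalize Clause.restrict q C = K at *
  generalize Cnf.restrict q F = G at *
  by_cases hK : Clause.satAt t' K
  · refine ⟨t', h1, fun D hD => ?_⟩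
    by_cases hDK : D = K
    · exact hDK ▸ hK
    · exact h2 D (Finset.mem_erase.2 ⟨hDK, hD⟩)
  obtain ⟨b, hb⟩ := hKv
  have hf : ∀ u c, (⟨u, c⟩ : Lit V) ∈ K → t' u = !c := by
    intro u c huc
    by_contra hne
    refine hK ⟨⟨u, c⟩, huc, ?_⟩
    change t' u = c
    revert hne
    cases t' u <;> cases c <;> simp
  refine ⟨Function.update t' v b, fun w hw => ?_, fun D hD => ?_⟩
  · have : w ≠ v := fun h => hw (h ▸ hvX)
    rw [Function.update_of_ne this, h1 w hw]
  by_cases hDK : D = K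
  · exact ⟨⟨v, b⟩, hDK ▸ hb, by simp⟩
  obtain ⟨⟨w, c⟩, hl, hlt⟩ := h2 D (Finset.mem_erase.2 ⟨hDK, hD⟩)
  have hlt' : t' w = c := hlt
  by_cases hwv : w = v
  · subst hwv
    have hc : c = !b := by rw [← hlt', hf w b hb]
    subst hc
    by_contra hns
    refine hblk D hD ⟨⟨b, hb, hl⟩, fun u hu c hc hcD => hns ⟨⟨u, !c⟩, hcD, ?_⟩⟩
    change Function.update t' w b u = !c
    rw [Function.update_of_ne hu, hf u c hc]
  · refine ⟨⟨w, c⟩, hl, ?_⟩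
    change Function.update t' v b w = c
    rw [Function.update_of_ne hwv, hlt']

end

end QE
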